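/- arXiv:quant-ph/0404096 — 2 statements merged into one kernel-verified Lean document; each statement's English description precedes it below -/
import Mathlib

section
/- Fix d = 2^k with k ≥ 1 and let u = H^{⊗k} be the k-fold tensor power of the Hadamard unitary on C^d (so that |u_{ij}| = 1/√d for all i,j). On H_A⊗H_B with H_A = C^d_{A1}⊗C²_{A2} and H_B = C^d_{B1}⊗C²_{B2}, let σ = (1/d)Σᵢ|ii⟩⟨ii| and U = Σ_{i,j} u_{ij}|ii⟩⟨jj| on C^d_{A1}⊗C^d_{B1}, and define ρ_AB = (1/2)[σ⊗|00⟩⟨00| + (1/d)Uᵀ⊗|00⟩⟨11| + (1/d)Ū⊗|11⟩⟨00| + σ⊗|11⟩⟨11|], where |ab⟩ denotes the computational basis state of the qubit pair (A2,B2). Then the entanglement of formation of ρ_AB across the cut A : B satisfies E_F(ρ_AB) ≥ (log₂ d)/2 = k/2. -/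
open Matrix BigOperators
open scoped ComplexOrder

/-- A density matrix: positive semidefinite with trace 1. -/
def IsDensity {m : Type*} [Fintype m] (ρ : Matrix m m ℂ) : Prop :=
  ρ.PosSemidef ∧ ρ.trace = 1

/-- The Hadamard unitary on `C²`. -/
noncomputable def hadamard : Matrix (Fin 2) (Fin 2) ℂ :=
  (((Real.sqrt 2 : ℝ) : ℂ))⁻¹ • !![1, 1; 1, -1]

/-- The `k`-fold tensor (Kronecker) power `H^{⊗k}` of the Hadamard unitary, as a matrix
on `C^{2^k}`. -/
noncomputable def hadamardPow : (k : ℕ) → Matrix (Fin (2 ^ k)) (Fin (2 ^ k)) ℂ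
  | 0 => 1
  | k + 1 =>
    Matrix.reindex (finProdFinEquiv.trans (finCongr (by ring)))
      (finProdFinEquiv.trans (finCongr (by ring)))
      (Matrix.kroneckerMap (· * ·) hadamard (hadamardPow k))

/-- The separable maximally correlated state `σ = (1/d) Σᵢ |ii⟩⟨ii|` on `C^d ⊗ C^d`. -/
noncomputable def maxCorr (d : ℕ) : Matrix (Fin d × Fin d) (Fin d × Fin d) ℂ :=
  fun p q => if p.1 = p.2 ∧ q.1 = q.2 ∧ p.1 = q.1 then ((d : ℂ))⁻¹ else 0

/-- `U = Σ_{i,j} u_{ij} |ii⟩⟨jj|` on `C^d ⊗ C^d`. -/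
noncomputable def diagU {d : ℕ} (u : Matrix (Fin d) (Fin d) ℂ) :
    Matrix (Fin d × Fin d) (Fin d × Fin d) ℂ :=
  fun p q => if p.1 = p.2 ∧ q.1 = q.2 then u p.1 q.1 else 0

/-- `M ⊗ |q⟩⟨r|` where `M` lives on `A1 ⊗ B1` and `|q⟩⟨r|` on the qubit pair `(A2, B2)`;
the result is arranged on `(A1 × A2) × (B1 × B2)`, i.e. across the `A : B` cut. -/
noncomputable def embedQ {d : ℕ} (M : Matrix (Fin d × Fin d) (Fin d × Fin d) ℂ)
    (q r : Fin 2 × Fin 2) :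
    Matrix ((Fin d × Fin 2) × (Fin d × Fin 2)) ((Fin d × Fin 2) × (Fin d × Fin 2)) ℂ :=
  fun x y =>
    if x.1.2 = q.1 ∧ x.2.2 = q.2 ∧ y.1.2 = r.1 ∧ y.2.2 = r.2 then
      M (x.1.1, x.2.1) (y.1.1, y.2.1) else 0

/-- The locking state
`ρ_AB = (1/2)[σ⊗|00⟩⟨00| + (1/d)Uᵀ⊗|00⟩⟨11| + (1/d)Ū⊗|11⟩⟨00| + σ⊗|11⟩⟨11|]`. -/
noncomputable def lockState {d : ℕ} (u : Matrix (Fin d) (Fin d) ℂ) :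
    Matrix ((Fin d × Fin 2) × (Fin d × Fin 2)) ((Fin d × Fin 2) × (Fin d × Fin 2)) ℂ :=
  (2 : ℂ)⁻¹ • (embedQ (maxCorr d) (0, 0) (0, 0)
    + ((d : ℂ))⁻¹ • embedQ (diagU u)ᵀ (0, 0) (1, 1)
    + ((d : ℂ))⁻¹ • embedQ ((diagU u).map (starRingEnd ℂ)) (1, 1) (0, 0)
    + embedQ (maxCorr d) (1, 1) (1, 1))

/-- Von Neumann entropy `S(ρ) = −Tr ρ log₂ ρ` (via eigenvalues, `0 log 0 = 0`). -/
noncomputable def vnEntropy {m : Type*} [Fintype m] [DecidableEq m]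
    (ρ : Matrix m m ℂ) : ℝ :=
  if h : ρ.IsHermitian then -∑ i, h.eigenvalues i * Real.logb 2 (h.eigenvalues i) else 0

/-- Partial trace over the second (Bob's) factor. -/
noncomputable def ptraceB {m n : Type*} [Fintype m] [Fintype n]
    (M : Matrix (m × n) (m × n) ℂ) : Matrix m m ℂ :=
  fun a a' => ∑ b, M (a, b) (a', b)

/-- Entanglement of formation: the infimum of `Σᵢ pᵢ S(Tr_B |ψᵢ⟩⟨ψᵢ|)` over all finite
pure-state ensembles `Σᵢ pᵢ |ψᵢ⟩⟨ψᵢ| = ρ`. -/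
noncomputable def eof {m n : Type*} [Fintype m] [Fintype n] [DecidableEq m]
    (ρ : Matrix (m × n) (m × n) ℂ) : ℝ :=
  sInf {x : ℝ | ∃ (k : ℕ) (p : Fin k → ℝ) (ψ : Fin k → (m × n → ℂ)),
    (∀ i, 0 ≤ p i) ∧ (∑ i, p i = 1) ∧
    (∀ i, ∑ z, Complex.normSq (ψ i z) = 1) ∧
    (ρ = ∑ i, ((p i : ℝ) : ℂ) • Matrix.vecMulVec (ψ i) (star (ψ i))) ∧
    x = ∑ i, p i * vnEntropy (ptraceB (Matrix.vecMulVec (ψ i) (star (ψ i))))}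


/-- The binary entropy dominates its quadratic approximation. -/
lemma four_mul_log_two_mul_le_binEntropy {p : ℝ} (h0 : 0 ≤ p) (h1 : p ≤ 1) :
    4 * Real.log 2 * (p * (1 - p)) ≤ Real.binEntropy p := by
  set f : ℝ → ℝ := fun p => Real.binEntropy p - 4 * Real.log 2 * (p * (1 - p)) with hf
  suffices h : ∀ p, 0 ≤ p → p ≤ 1 / 2 → 0 ≤ f p by
    rcases le_total p (1 / 2) with hp | hp
    · exact sub_nonneg.mp (h p h0 hp)
    · have := sub_nonneg.mp (h (1 - p) (by linarith) (by linarith))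
      rw [Real.binEntropy_one_sub] at this
      linarith
  have hlog : 0.6931471803 < Real.log 2 := Real.log_two_gt_d9
  have hlog' : Real.log 2 < 0.6931471808 := Real.log_two_lt_d9
  have hcont : Continuous f := by fun_prop
  have hsymm : ∀ p, f (1 - p) = f p := fun p => by
    simp only [hf, Real.binEntropy_one_sub]; ring
  have hhalf : f (1 / 2) = 0 := by
    simp only [hf, one_div, Real.binEntropy_two_inv]; ring
  have hzero : f 0 = 0 := by simp [hf]
  have hd1 : ∀ x, 0 < x → x < 1 → HasDerivAt f
      (Real.log (1 - x) - Real.log x - 4 * Real.log 2 * (1 - 2 * x)) x := fun x hx hx' => by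
    refine ((Real.hasDerivAt_binEntropy hx.ne' hx'.ne).sub (((hasDerivAt_id' x).mul
      ((hasDerivAt_id' x).const_sub 1)).const_mul (4 * Real.log 2))).congr_deriv ?_
    ring
  have hd2 : ∀ x, 0 < x → x < 1 → HasDerivAt
      (fun x => Real.log (1 - x) - Real.log x - 4 * Real.log 2 * (1 - 2 * x))
      (8 * Real.log 2 - 1 / (x * (1 - x))) x := fun x hx hx' => by
    have h1x : 1 - x ≠ 0 := by linarith
    refine (((((hasDerivAt_id' x).const_sub 1).log h1x).sub (Real.hasDerivAt_log hx.ne')).sub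
      ((((hasDerivAt_id' x).const_mul 2).const_sub 1).const_mul (4 * Real.log 2))).congr_deriv ?_
    field_simp
    ring
  set s : ℝ := √(1 / 4 - 1 / (8 * Real.log 2)) with hs
  have hnn : 0 ≤ 1 / 4 - 1 / (8 * Real.log 2) := by
    rw [sub_nonneg, div_le_div_iff₀ (by positivity) (by positivity)]; linarith
  have hs2 : s ^ 2 = 1 / 4 - 1 / (8 * Real.log 2) := Real.sq_sqrt hnn
  have hs0 : 0 ≤ s := Real.sqrt_nonneg _
  have hinv : 0 < 1 / (8 * Real.log 2) := by positivity
  have hs1 : s < 1 / 2 := by nlinarith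
  have hconv : ConvexOn ℝ (Set.Icc (1 / 2 - s) (1 / 2 + s)) f := by
    refine convexOn_of_hasDerivWithinAt2_nonneg (convex_Icc _ _) hcont.continuousOn
      (f' := fun x => Real.log (1 - x) - Real.log x - 4 * Real.log 2 * (1 - 2 * x))
      (f'' := fun x => 8 * Real.log 2 - 1 / (x * (1 - x))) ?_ ?_ ?_ <;> intro x hx <;>
      rw [interior_Icc] at hx <;> obtain ⟨hxl, hxr⟩ := hx
    · exact (hd1 x (by linarith) (by linarith)).hasDerivWithinAt
    · exact (hd2 x (by linarith) (by linarith)).hasDerivWithinAt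
    · have hpos : 0 < x * (1 - x) := mul_pos (by linarith) (by linarith)
      have : 1 / (8 * Real.log 2) ≤ x * (1 - x) := by nlinarith
      rw [sub_nonneg, div_le_iff₀ hpos]
      rw [div_le_iff₀ (by positivity)] at this
      linarith
  have hmid : ∀ p ∈ Set.Icc (1 / 2 - s) (1 / 2 : ℝ), 0 ≤ f p := fun p hp => by
    have := hconv.2 (show p ∈ _ from ⟨hp.1, by linarith [hp.2]⟩)
      (show 1 - p ∈ _ from ⟨by linarith [hp.2], by linarith [hp.1]⟩)
      (show (0 : ℝ) ≤ 1 / 2 by norm_num) (show (0 : ℝ) ≤ 1 / 2 by norm_num) (by norm_num)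
    rw [hsymm, smul_eq_mul, smul_eq_mul, smul_eq_mul,
      show 1 / 2 * p + 1 / 2 * (1 - p) = 1 / 2 by ring, hhalf] at this
    linarith
  have hconc : ConcaveOn ℝ (Set.Icc 0 (1 / 2 - s)) f := by
    refine concaveOn_of_hasDerivWithinAt2_nonpos (convex_Icc _ _) hcont.continuousOn
      (f' := fun x => Real.log (1 - x) - Real.log x - 4 * Real.log 2 * (1 - 2 * x))
      (f'' := fun x => 8 * Real.log 2 - 1 / (x * (1 - x))) ?_ ?_ ?_ <;> intro x hx <;>
      rw [interior_Icc] at hx <;> obtain ⟨hxl, hxr⟩ := hx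
    · exact (hd1 x (by linarith) (by linarith)).hasDerivWithinAt
    · exact (hd2 x (by linarith) (by linarith)).hasDerivWithinAt
    · have hpos : 0 < x * (1 - x) := mul_pos (by linarith) (by linarith)
      have : x * (1 - x) ≤ 1 / (8 * Real.log 2) := by nlinarith
      rw [sub_nonpos, le_div_iff₀ hpos]
      rw [le_div_iff₀ (by positivity)] at this
      linarith
  intro p hp hp'
  rcases le_total (1 / 2 - s) p with h | h
  · exact hmid p ⟨h, hp'⟩
  · have hmin := hconc.min_le_of_mem_Icc (x := 0) (y := 1 / 2 - s) (z := p)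
      ⟨le_rfl, by linarith⟩ ⟨by linarith, le_rfl⟩ ⟨hp, h⟩
    refine le_trans (le_min ?_ ?_) hmin
    · rw [hzero]
    · exact hmid _ ⟨le_rfl, by linarith⟩

open Real in
lemma mul_log_two_le_negMulLog_add {a b : ℝ} (ha : 0 ≤ a) (hb : 0 ≤ b) :
    4 * a * b / (a + b) * log 2 ≤ negMulLog a + negMulLog b - negMulLog (a + b) := by
  rcases (add_nonneg ha hb).eq_or_lt with h | h
  · obtain ⟨rfl, rfl⟩ := (add_eq_zero_iff_of_nonneg ha hb).mp h.symm
    simp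
  · have hp := four_mul_log_two_mul_le_binEntropy (p := a / (a + b)) (by positivity)
      ((div_le_one h).mpr (by linarith))
    have hq : 1 - a / (a + b) = b / (a + b) := by field_simp; ring
    rw [binEntropy_eq_negMulLog_add_negMulLog_one_sub, hq] at hp
    have hA : negMulLog a = a / (a + b) * negMulLog (a + b)
        + (a + b) * negMulLog (a / (a + b)) := by
      rw [← negMulLog_mul, mul_div_cancel₀ _ h.ne']
    have hB : negMulLog b = b / (a + b) * negMulLog (a + b)
        + (a + b) * negMulLog (b / (a + b)) := by
      rw [← negMulLog_mul, mul_div_cancel₀ _ h.ne']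
    have hsum : a / (a + b) + b / (a + b) = 1 := by field_simp
    have hL : 4 * a * b / (a + b) * log 2
        = (a + b) * (4 * log 2 * (a / (a + b) * (b / (a + b)))) := by field_simp
    rw [hL, hA, hB]
    have := mul_le_mul_of_nonneg_left hp h.le
    linear_combination this - negMulLog (a + b) * hsum

open Real in
/-- Subadditivity of the Shannon entropy, for unnormalised weights. -/
lemma sum_negMulLog_add_le {m n : Type*} [Fintype m] [Fintype n] (P : m → n → ℝ)
    (hP : ∀ i j, 0 ≤ P i j) :
    ∑ i, ∑ j, negMulLog (P i j) + negMulLog (∑ i, ∑ j, P i j)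
      ≤ ∑ i, negMulLog (∑ j, P i j) + ∑ j, negMulLog (∑ i, P i j) := by
  set T := ∑ i, ∑ j, P i j with hT
  set w : m → ℝ := fun i => ∑ j, P i j with hw
  set v : n → ℝ := fun j => ∑ i, P i j with hv
  have hw0 : ∀ i, 0 ≤ w i := fun i => Finset.sum_nonneg fun j _ => hP i j
  have hv0 : ∀ j, 0 ≤ v j := fun j => Finset.sum_nonneg fun i _ => hP i j
  have hT0 : 0 ≤ T := Finset.sum_nonneg fun i _ => hw0 i
  have hTv : T = ∑ j, v j := Finset.sum_comm
  have key : ∀ i j, P i j * (log (w i) + log (v j) - log (P i j) - log T)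
      ≤ w i * v j / T - P i j := fun i j => by
    rcases (hP i j).eq_or_lt with h | h
    · rw [← h, zero_mul, sub_zero]
      exact div_nonneg (mul_nonneg (hw0 i) (hv0 j)) hT0
    · have hwi : 0 < w i :=
        h.trans_le (Finset.single_le_sum (fun j _ => hP i j) (Finset.mem_univ j))
      have hvj : 0 < v j :=
        h.trans_le (Finset.single_le_sum (fun i _ => hP i j) (Finset.mem_univ i))
      have hTp : 0 < T :=
        hwi.trans_le (Finset.single_le_sum (fun i _ => hw0 i) (Finset.mem_univ i))
      have hlog := log_le_sub_one_of_pos (x := w i * v j / (P i j * T)) (by positivity)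
      rw [log_div (by positivity) (by positivity), log_mul hwi.ne' hvj.ne',
        log_mul h.ne' hTp.ne'] at hlog
      have := mul_le_mul_of_nonneg_left hlog h.le
      have e : P i j * (w i * v j / (P i j * T) - 1) = w i * v j / T - P i j := by
        field_simp
      linarith
  have hsum := Finset.sum_le_sum fun i (_ : i ∈ Finset.univ) =>
    Finset.sum_le_sum fun j (_ : j ∈ Finset.univ) => key i j
  have hR : ∑ i, ∑ j, (w i * v j / T - P i j) = 0 := by
    simp_rw [Finset.sum_sub_distrib, ← Finset.sum_div, ← Finset.mul_sum, ← Finset.sum_mul, ← hTv]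
    rw [show ∑ i, w i = T from rfl]
    rcases hT0.eq_or_lt with h | h
    · simp [← h]
    · field_simp; ring
  have hL : ∑ i, ∑ j, P i j * (log (w i) + log (v j) - log (P i j) - log T)
      = ∑ i, w i * log (w i) + ∑ j, v j * log (v j) - ∑ i, ∑ j, P i j * log (P i j)
        - T * log T := by
    simp_rw [mul_sub, mul_add, Finset.sum_sub_distrib, Finset.sum_add_distrib]
    congr 2
    · congr 1
      · simp_rw [← Finset.sum_mul]; rfl
      · rw [Finset.sum_comm]; simp_rw [← Finset.sum_mul]; rfl
    · simp_rw [← Finset.sum_mul]; rfl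
  rw [hL, hR] at hsum
  simp only [negMulLog_eq_neg, Finset.sum_neg_distrib]
  linarith

open Real in
/-- An isometry `M` satisfies the entropic uncertainty relation with constant `L` if the Shannon
entropies of `ψ` and `M ψ` add up to at least `L`, here for unnormalised `ψ`. -/
structure EntropicUncertainty {n : Type*} [Fintype n] [DecidableEq n] (M : Matrix n n ℂ) (L : ℝ) :
    Prop where
  isometry : Mᴴ * M = 1
  bound : ∀ ψ : n → ℂ,
    L * ∑ i, Complex.normSq (ψ i) + 2 * negMulLog (∑ i, Complex.normSq (ψ i))
      ≤ ∑ i, negMulLog (Complex.normSq (ψ i)) + ∑ i, negMulLog (Complex.normSq ((M *ᵥ ψ) i))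

lemma coe_sum_normSq {n : Type*} [Fintype n] (ψ : n → ℂ) :
    ((∑ i, Complex.normSq (ψ i) : ℝ) : ℂ) = star ψ ⬝ᵥ ψ := by
  simp [dotProduct, Complex.normSq_eq_conj_mul_self]

lemma sum_normSq_mulVec {n : Type*} [Fintype n] [DecidableEq n] {M : Matrix n n ℂ}
    (hM : Mᴴ * M = 1) (ψ : n → ℂ) :
    ∑ i, Complex.normSq ((M *ᵥ ψ) i) = ∑ i, Complex.normSq (ψ i) := by
  rw [← Complex.ofReal_inj, coe_sum_normSq, coe_sum_normSq, star_mulVec, dotProduct_mulVec,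
    vecMul_vecMul, hM, vecMul_one]

namespace EntropicUncertainty

lemma one {n : Type*} [Unique n] [Fintype n] [DecidableEq n] :
    EntropicUncertainty (1 : Matrix n n ℂ) 0 where
  isometry := by simp
  bound ψ := by simp [two_mul]

lemma reindex {m n : Type*} [Fintype m] [Fintype n] [DecidableEq m] [DecidableEq n]
    {M : Matrix m m ℂ} {L : ℝ} (h : EntropicUncertainty M L) (e : m ≃ n) :
    EntropicUncertainty (Matrix.reindex e e M) L where
  isometry := by
    rw [conjTranspose_reindex, reindex_apply, reindex_apply, submatrix_mul_equiv, h.isometry,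
      submatrix_one_equiv]
  bound ψ := by
    have := h.bound (ψ ∘ e)
    have e1 : ∀ f : ℂ → ℝ, ∑ i, f ((ψ ∘ e) i) = ∑ i, f (ψ i) := fun f =>
      e.sum_comp fun i => f (ψ i)
    have e2 : ∑ i, Real.negMulLog (Complex.normSq ((M *ᵥ (ψ ∘ e)) i))
        = ∑ i, Real.negMulLog (Complex.normSq ((Matrix.reindex e e M *ᵥ ψ) i)) := by
      rw [← e.sum_comp]
      refine Finset.sum_congr rfl fun i _ => ?_
      rw [reindex_apply, submatrix_mulVec_equiv]
      simp
    rw [e1 (fun z => Complex.normSq z), e1 (fun z => Real.negMulLog (Complex.normSq z)), e2] at this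
    exact this

open Real in
/-- Entropic uncertainty relations tensorise: measure the two factors one after the other, and
bound the mutual information of the intermediate distribution below by `0`. -/
lemma kronecker {m n : Type*} [Fintype m] [Fintype n] [DecidableEq m] [DecidableEq n]
    {M : Matrix m m ℂ} {N : Matrix n n ℂ} {L K : ℝ} (hM : EntropicUncertainty M L)
    (hN : EntropicUncertainty N K) :
    EntropicUncertainty (kroneckerMap (· * ·) M N) (L + K) where
  isometry := by
    rw [conjTranspose_kronecker, ← mul_kronecker_mul, hM.isometry, hN.isometry, one_kronecker_one]
  bound ψ := by
    set φ : m → n → ℂ := fun z => N *ᵥ fun j => ψ (z, j) with hφ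
    have hχ : ∀ y x, (kroneckerMap (· * ·) M N *ᵥ ψ) (y, x) = (M *ᵥ fun z => φ z x) y :=
      fun y x => by
        simp only [mulVec, dotProduct, kroneckerMap_apply, Fintype.sum_prod_type, hφ,
          Finset.mul_sum, mul_assoc]
    simp only [Fintype.sum_prod_type, hχ]
    have hw : ∀ z, ∑ j, Complex.normSq (ψ (z, j)) = ∑ x, Complex.normSq (φ z x) := fun z =>
      (sum_normSq_mulVec hN.isometry fun j => ψ (z, j)).symm
    have h1 := Finset.sum_le_sum fun z (_ : z ∈ Finset.univ) => hN.bound fun j => ψ (z, j)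
    have h2 := Finset.sum_le_sum fun x (_ : x ∈ Finset.univ) => hM.bound fun z => φ z x
    have h3 := sum_negMulLog_add_le (fun z x => Complex.normSq (φ z x))
      fun _ _ => Complex.normSq_nonneg _
    simp only [Finset.sum_add_distrib, ← Finset.mul_sum, hw] at h1 h2 ⊢
    rw [Finset.sum_comm (f := fun x z => Complex.normSq (φ z x)),
      Finset.sum_comm (f := fun x z => negMulLog (Complex.normSq (φ z x))),
      Finset.sum_comm (f := fun x y => negMulLog (Complex.normSq ((M *ᵥ fun z => φ z x) y)))] at h2
    change _ ≤ _ + ∑ z, ∑ x, negMulLog (Complex.normSq (φ z x)) at h1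
    linarith

open Real in
lemma hadamard : EntropicUncertainty hadamard (log 2) where
  isometry := by
    have h : ((√2 : ℝ) : ℂ) * ((√2 : ℝ) : ℂ) = 2 := by
      rw [← Complex.ofReal_mul, mul_self_sqrt (by norm_num)]; norm_num
    have h' : (((√2 : ℝ) : ℂ))⁻¹ * (((√2 : ℝ) : ℂ))⁻¹ = 2⁻¹ := by rw [← mul_inv, h]
    ext i j
    fin_cases i <;> fin_cases j <;>
      simp [_root_.hadamard, mul_apply, Fin.sum_univ_two, h'] <;> norm_num
  bound ψ := by
    have hinv : Complex.normSq (((√2 : ℝ) : ℂ))⁻¹ = 1 / 2 := by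
      rw [map_inv₀, Complex.normSq_ofReal, mul_self_sqrt (by norm_num), one_div]
    have e0 : (_root_.hadamard *ᵥ ψ) 0 = (((√2 : ℝ) : ℂ))⁻¹ * (ψ 0 + ψ 1) := by
      simp [_root_.hadamard, mulVec, dotProduct, Fin.sum_univ_two]; ring
    have e1 : (_root_.hadamard *ᵥ ψ) 1 = (((√2 : ℝ) : ℂ))⁻¹ * (ψ 0 - ψ 1) := by
      simp [_root_.hadamard, mulVec, dotProduct, Fin.sum_univ_two]; ring
    simp only [Fin.sum_univ_two, e0, e1, Complex.normSq_mul, hinv]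
    obtain ⟨x, y⟩ := ψ 0
    obtain ⟨z, w⟩ := ψ 1
    simp only [Complex.normSq_apply, Complex.add_re, Complex.add_im, Complex.sub_re,
      Complex.sub_im]
    set a := x * x + y * y with ha
    set b := z * z + w * w with hb
    set c := 1 / 2 * ((x + z) * (x + z) + (y + w) * (y + w)) with hc
    set d := 1 / 2 * ((x - z) * (x - z) + (y - w) * (y - w)) with hd
    have ha0 : 0 ≤ a := by linarith [mul_self_nonneg x, mul_self_nonneg y]
    have hb0 : 0 ≤ b := by linarith [mul_self_nonneg z, mul_self_nonneg w]
    have hc0 : 0 ≤ c := by linarith [mul_self_nonneg (x + z), mul_self_nonneg (y + w)]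
    have hd0 : 0 ≤ d := by linarith [mul_self_nonneg (x - z), mul_self_nonneg (y - w)]
    have hcd : c + d = a + b := by rw [ha, hb, hc, hd]; ring
    have h1 := mul_log_two_le_negMulLog_add ha0 hb0
    have h2 := mul_log_two_le_negMulLog_add hc0 hd0
    rw [hcd] at h2
    have h3 : a + b ≤ 4 * a * b / (a + b) + 4 * c * d / (a + b) := by
      rcases (add_nonneg ha0 hb0).eq_or_lt with h | h
      · simp [← h]
      · rw [← add_div, le_div_iff₀ h]
        have : 4 * a * b + 4 * c * d - (a + b) * (a + b) = 4 * (x * w - y * z) ^ 2 := by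
          rw [ha, hb, hc, hd]; ring
        nlinarith [sq_nonneg (x * w - y * z)]
    have := mul_le_mul_of_nonneg_right h3 (log_nonneg one_le_two)
    linarith

lemma hadamardPow (k : ℕ) : EntropicUncertainty (hadamardPow k) (k * Real.log 2) := by
  induction k with
  | zero =>
    have : Unique (Fin (2 ^ 0)) := inferInstanceAs (Unique (Fin 1))
    simpa [_root_.hadamardPow] using EntropicUncertainty.one (n := Fin (2 ^ 0))
  | succ k ih =>
    have h := (hadamard.kronecker ih).reindex
      (finProdFinEquiv.trans (finCongr (show 2 * 2 ^ k = 2 ^ (k + 1) by ring)))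
    have e : ((k + 1 : ℕ) : ℝ) * Real.log 2 = Real.log 2 + k * Real.log 2 := by push_cast; ring
    rw [e, _root_.hadamardPow]
    exact h

end EntropicUncertainty

lemma hadamardPow_transpose (k : ℕ) : (hadamardPow k)ᵀ = hadamardPow k := by
  induction k with
  | zero => simp [hadamardPow]
  | succ k ih =>
    have h : _root_.hadamardᵀ = _root_.hadamard := by
      ext i j; fin_cases i <;> fin_cases j <;> simp [_root_.hadamard]
    rw [hadamardPow, transpose_reindex, ← kroneckerMap_transpose, h, ih]

/-- The von Neumann entropy of a diagonal matrix is the Shannon entropy of its diagonal. -/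
lemma vnEntropy_diagonal {m : Type*} [Fintype m] [DecidableEq m] (q : m → ℝ) :
    vnEntropy (diagonal fun i => (q i : ℂ)) = (∑ i, Real.negMulLog (q i)) / Real.log 2 := by
  have hH : (diagonal fun i => (q i : ℂ)).IsHermitian :=
    isHermitian_diagonal_iff.mpr fun i => by simp [isSelfAdjoint_iff]
  have hroots := hH.roots_charpoly_eq_eigenvalues
  rw [charpoly_diagonal, Polynomial.roots_prod _ _
    (Finset.prod_ne_zero_iff.mpr fun i _ => Polynomial.X_sub_C_ne_zero _)] at hroots
  simp only [Polynomial.roots_X_sub_C, Multiset.bind_singleton] at hroots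
  have hs := congrArg (fun s => (s.map fun z : ℂ => Real.negMulLog z.re).sum) hroots
  simp only [Multiset.map_map, Function.comp_def, Complex.ofReal_re,
    Complex.coe_algebraMap] at hs
  change ∑ i, Real.negMulLog (q i) = ∑ i, Real.negMulLog (hH.eigenvalues i) at hs
  rw [vnEntropy, dif_pos hH, hs, Finset.sum_div, ← Finset.sum_neg_distrib]
  refine Finset.sum_congr rfl fun i _ => ?_
  rw [Real.negMulLog, Real.logb]
  ring

/-- The columns of `lockFactor u` are the unnormalised vectors
`Σᵢ u_{ji} |ii⟩|00⟩ + |jj⟩|11⟩`, which generate the locking state. -/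
def lockFactor {d : ℕ} (u : Matrix (Fin d) (Fin d) ℂ) :
    Matrix ((Fin d × Fin 2) × (Fin d × Fin 2)) (Fin d) ℂ :=
  fun z j => if z.1 = z.2 then (if z.1.2 = 0 then u j z.1.1 else if z.1.1 = j then 1 else 0) else 0

lemma lockState_eq_smul {d : ℕ} {u : Matrix (Fin d) (Fin d) ℂ} (hu : uᴴ * u = 1) :
    lockState u = (2 * d : ℂ)⁻¹ • (lockFactor u * (lockFactor u)ᴴ) := by
  have hu' : ∀ i i', ∑ j, u j i * starRingEnd ℂ (u j i') = if i = i' then 1 else 0 := fun i i' => by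
    have := congrFun (congrFun hu i') i
    simp only [mul_apply, conjTranspose_apply, one_apply, eq_comm (a := i')] at this
    simpa only [mul_comm, starRingEnd_apply] using this
  ext ⟨⟨i, a⟩, ⟨j, b⟩⟩ ⟨⟨i', a'⟩, ⟨j', b'⟩⟩
  by_cases hij : i = j <;> by_cases hij' : i' = j' <;>
  fin_cases a <;> fin_cases b <;> fin_cases a' <;> fin_cases b' <;>
    simp [lockState, embedQ, maxCorr, diagU, lockFactor, mul_apply, hij, hij', apply_ite star,
      mul_comm]
  · rw [hu']
    split_ifs <;> ring
  · ring
  · ring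

lemma eof_set_nonempty {d : ℕ} (hd : 0 < d) {u : Matrix (Fin d) (Fin d) ℂ} (hu : uᴴ * u = 1) :
    ∃ (k : ℕ) (p : Fin k → ℝ) (ψ : Fin k → ((Fin d × Fin 2) × (Fin d × Fin 2) → ℂ)),
      (∀ i, 0 ≤ p i) ∧ (∑ i, p i = 1) ∧ (∀ i, ∑ z, Complex.normSq (ψ i z) = 1) ∧
      lockState u = ∑ i, ((p i : ℝ) : ℂ) • vecMulVec (ψ i) (star (ψ i)) := by
  have h2 : ((√2 : ℝ) : ℂ)⁻¹ * ((√2 : ℝ) : ℂ)⁻¹ = 2⁻¹ := by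
    rw [← mul_inv, ← Complex.ofReal_mul, Real.mul_self_sqrt (by norm_num)]; norm_num
  have hn2 : Complex.normSq (((√2 : ℝ) : ℂ))⁻¹ = 1 / 2 := by
    rw [map_inv₀, Complex.normSq_ofReal, Real.mul_self_sqrt (by norm_num), one_div]
  refine ⟨d, fun _ => (d : ℝ)⁻¹, fun j z => ((√2 : ℝ) : ℂ)⁻¹ * lockFactor u z j,
    fun _ => by positivity, ?_, fun j => ?_, ?_⟩
  · simp [hd.ne']
  · have hrow : ∑ i, Complex.normSq (u j i) = 1 := by
      have := congrFun (congrFun (show u * uᴴ = 1 from mul_eq_one_comm.mp hu) j) j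
      simp only [mul_apply, conjTranspose_apply, one_apply_eq] at this
      rw [← Complex.ofReal_inj, Complex.ofReal_sum, Complex.ofReal_one, ← this]
      exact Finset.sum_congr rfl fun i _ => (Complex.mul_conj _).symm
    simp only [Complex.normSq_mul, hn2, ← Finset.mul_sum, Fintype.sum_prod_type (α₁ := Fin d × Fin 2),
      lockFactor, apply_ite Complex.normSq, map_zero, Finset.sum_ite_eq, Finset.mem_univ, if_true]
    rw [Fintype.sum_prod_type]
    simp [Finset.sum_add_distrib, hrow]
    norm_num
  · rw [lockState_eq_smul hu]
    ext z z'
    simp only [Matrix.smul_apply, mul_apply, conjTranspose_apply, Matrix.sum_apply, vecMulVec_apply,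
      Pi.star_apply, star_mul', smul_eq_mul, Finset.mul_sum]
    refine Finset.sum_congr rfl fun j _ => ?_
    have hs : star (((√2 : ℝ) : ℂ)⁻¹) = ((√2 : ℝ) : ℂ)⁻¹ := by
      rw [star_inv₀]; simp
    rw [hs, mul_inv, ← h2, Complex.ofReal_inv, Complex.ofReal_natCast]
    ring

/-- A functional that vanishes on the range of a mixed state vanishes on every pure state that
occurs with positive weight in an ensemble for it. -/
lemma dotProduct_eq_zero_of_ensemble {m n : Type*} [Fintype m] [Fintype n] {k : ℕ} {c : ℂ}
    {V : Matrix m n ℂ} {p : Fin k → ℝ} {ψ : Fin k → m → ℂ} (hp : ∀ i, 0 ≤ p i)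
    (h : c • (V * Vᴴ) = ∑ i, ((p i : ℝ) : ℂ) • vecMulVec (ψ i) (star (ψ i)))
    {f : m → ℂ} (hf : f ᵥ* V = 0) {i : Fin k} (hi : p i ≠ 0) : f ⬝ᵥ ψ i = 0 := by
  have h0 : f ⬝ᵥ ((c • (V * Vᴴ)) *ᵥ star f) = 0 := by
    rw [dotProduct_mulVec, vecMul_smul, ← vecMul_vecMul, hf, zero_vecMul, smul_zero,
      zero_dotProduct]
  have h1 : f ⬝ᵥ ((∑ i, ((p i : ℝ) : ℂ) • vecMulVec (ψ i) (star (ψ i))) *ᵥ star f)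
      = ((∑ i, p i * Complex.normSq (f ⬝ᵥ ψ i) : ℝ) : ℂ) := by
    rw [sum_mulVec, dotProduct_sum, Complex.ofReal_sum]
    refine Finset.sum_congr rfl fun i _ => ?_
    rw [smul_mulVec, dotProduct_smul, vecMulVec_mulVec, dotProduct_smul, Complex.ofReal_mul,
      ← Complex.mul_conj, starRingEnd_apply, star_dotProduct]
    simp
  rw [h, h1, Complex.ofReal_eq_zero, Finset.sum_eq_zero_iff_of_nonneg fun i _ =>
    mul_nonneg (hp i) (Complex.normSq_nonneg _)] at h0
  simpa [hi] using h0 i (Finset.mem_univ i)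

lemma ptraceB_vecMulVec {m : Type*} [Fintype m] [DecidableEq m] {ψ : m × m → ℂ}
    (hψ : ∀ z, z.1 ≠ z.2 → ψ z = 0) :
    ptraceB (vecMulVec ψ (star ψ))
      = diagonal fun a => ((Complex.normSq (ψ (a, a)) : ℝ) : ℂ) := by
  ext a a'
  rw [ptraceB, Finset.sum_eq_single a
    (fun b _ hb => by rw [vecMulVec_apply, hψ (a, b) hb.symm, zero_mul]) (by simp),
    vecMulVec_apply, diagonal_apply, Pi.star_apply]
  split_ifs with h
  · rw [← h]; exact Complex.mul_conj _
  · rw [hψ (a', a) (Ne.symm h), star_zero, mul_zero]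

open Real in
/-- Every pure state in the range of the locking state has entanglement at least `1 + L / 2`, with
`L` the entropic uncertainty constant in bits. -/
lemma le_vnEntropy_ptraceB {d : ℕ} {u : Matrix (Fin d) (Fin d) ℂ} {L : ℝ}
    (hu : EntropicUncertainty uᵀ L) {ψ : (Fin d × Fin 2) × (Fin d × Fin 2) → ℂ}
    (hnorm : ∑ z, Complex.normSq (ψ z) = 1)
    (hker : ∀ f, f ᵥ* lockFactor u = 0 → f ⬝ᵥ ψ = 0) :
    1 + L / log 2 / 2 ≤ vnEntropy (ptraceB (vecMulVec ψ (star ψ))) := by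
  have hoff : ∀ z, z.1 ≠ z.2 → ψ z = 0 := fun z hz => by
    have := hker (Pi.single z 1) (by
      rw [single_one_vecMul]
      ext j
      simp [lockFactor, hz])
    simpa using this
  set c : Fin d → ℂ := fun i => ψ ((i, 1), (i, 1)) with hc
  have ha : ∀ i, ψ ((i, 0), (i, 0)) = (uᵀ *ᵥ c) i := fun i => by
    have := hker (Pi.single ((i, 0), (i, 0)) 1 - ∑ j, u j i • Pi.single ((j, 1), (j, 1)) 1) (by
      rw [sub_vecMul, sum_vecMul, single_one_vecMul]
      ext l
      simp [smul_vecMul, lockFactor])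
    simp only [sub_dotProduct, sum_dotProduct, smul_dotProduct, single_one_dotProduct,
      sub_eq_zero] at this
    exact this
  have hT := sum_normSq_mulVec hu.isometry c
  have hhalf : ∑ i, Complex.normSq (c i) = 1 / 2 := by
    have hdiag : ∑ z, Complex.normSq (ψ z) = ∑ a, Complex.normSq (ψ (a, a)) := by
      rw [Fintype.sum_prod_type]
      refine Finset.sum_congr rfl fun a _ => ?_
      exact Finset.sum_eq_single a
        (fun b _ hb => by rw [hoff (a, b) hb.symm, map_zero]) (by simp)
    rw [hdiag, Fintype.sum_prod_type] at hnorm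
    simp only [Fin.sum_univ_two, Finset.sum_add_distrib, ha, hT] at hnorm
    change _ + ∑ i, Complex.normSq (c i) = 1 at hnorm
    linarith
  have hb := hu.bound c
  have hη : negMulLog (1 / 2) = log 2 / 2 := by
    rw [negMulLog, one_div, log_inv]; ring
  rw [hhalf, hη] at hb
  rw [ptraceB_vecMulVec hoff, vnEntropy_diagonal, Fintype.sum_prod_type]
  simp only [Fin.sum_univ_two, Finset.sum_add_distrib, ha]
  have hlog := log_pos one_lt_two
  rw [le_div_iff₀ hlog]
  have e : (1 + L / log 2 / 2) * log 2 = log 2 + L / 2 := by field_simp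
  rw [e]
  change _ ≤ _ + ∑ i, negMulLog (Complex.normSq (c i))
  linarith

/-- For `u = H^{⊗k}`, the entanglement of formation of the locking state across the
`A : B` cut is at least `(log₂ d)/2 = k/2`. -/
theorem eof_lockState_hadamard_ge (k : ℕ) (hk : 1 ≤ k) :
    eof (lockState (hadamardPow k)) ≥ (k : ℝ) / 2 := by
  have hEU := EntropicUncertainty.hadamardPow k
  have hEU' : EntropicUncertainty (hadamardPow k)ᵀ (k * Real.log 2) := by
    rwa [hadamardPow_transpose]
  have hlog : Real.log 2 ≠ 0 := (Real.log_pos one_lt_two).ne'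
  refine le_csInf ?_ ?_
  · obtain ⟨n, p, ψ, h0, h1, h2, h3⟩ := eof_set_nonempty (by positivity) hEU.isometry
    exact ⟨_, n, p, ψ, h0, h1, h2, h3, rfl⟩
  · rintro x ⟨n, p, ψ, h0, h1, h2, h3, rfl⟩
    rw [lockState_eq_smul hEU.isometry] at h3
    calc (k : ℝ) / 2 = ∑ i, p i * (k / 2) := by rw [← Finset.sum_mul, h1, one_mul]
      _ ≤ _ := Finset.sum_le_sum fun i _ => ?_
    by_cases hi : p i = 0
    · simp [hi]
    · refine mul_le_mul_of_nonneg_left ?_ (h0 i)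
      have := le_vnEntropy_ptraceB hEU' (h2 i) fun f hf =>
        dotProduct_eq_zero_of_ensemble h0 h3 hf hi
      rw [mul_div_cancel_right₀ _ hlog] at this
      linarith
end

section
/- Fix d = 2^k with k ≥ 1 and let u = H^{⊗k} be the k-fold tensor power of the Hadamard unitary on C^d (so that |u_{ij}| = 1/√d for all i,j). On H_A⊗H_B with H_A = C^d_{A1}⊗C²_{A2} and H_B = C^d_{B1}⊗C²_{B2}, let σ = (1/d)Σᵢ|ii⟩⟨ii| and U = Σ_{i,j} u_{ij}|ii⟩⟨jj| on C^d_{A1}⊗C^d_{B1}, and define ρ_AB = (1/2)[σ⊗|00⟩⟨00| + (1/d)Uᵀ⊗|00⟩⟨11| + (1/d)Ū⊗|11⟩⟨00| + σ⊗|11⟩⟨11|], where |ab⟩ denotes the computational basis state of the qubit pair (A2,B2). Then for every n ≥ 1, E_F(ρ_AB^{⊗n}) ≥ n·(log₂ d)/2 across the cut Aⁿ : Bⁿ; consequently the entanglement cost E_c(ρ_AB) = lim_{n→∞} E_F(ρ_AB^{⊗n})/n satisfies E_c(ρ_AB) ≥ (log₂ d)/2. -/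
open Matrix BigOperators
open scoped ComplexOrder

/-- `N`-fold tensor power of a bipartite matrix, with indices regrouped across the
`Aⁿ : Bⁿ` cut. -/
noncomputable def bipPow {a b : Type*} [Fintype a] [Fintype b]
    (M : Matrix (a × b) (a × b) ℂ) (N : ℕ) :
    Matrix ((Fin N → a) × (Fin N → b)) ((Fin N → a) × (Fin N → b)) ℂ :=
  fun x y => ∏ t, M (x.1 t, x.2 t) (y.1 t, y.2 t)

/-- The first-order form of the three lines theorem for exponential sums. -/
theorem re_sum_mul_le_zero_of_norm_exp_sum_le {ι : Type*} [Fintype ι] (K : ι → ℂ) (r : ι → ℝ)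
    (N : ℝ) (h0 : ∑ i, K i = N)
    (hl : ∀ z : ℂ, z.re = 0 → ‖∑ i, K i * Complex.exp (z * r i)‖ ≤ N)
    (hr : ∀ z : ℂ, z.re = 1 → ‖∑ i, K i * Complex.exp (z * r i)‖ ≤ N) :
    (∑ i, K i * r i).re ≤ 0 := by
  have hd : Differentiable ℂ fun z : ℂ => ∑ i, K i * Complex.exp (z * r i) := by fun_prop
  have hbd : ∀ z : ℂ, 0 ≤ z.re → z.re ≤ 1 → ‖∑ i, K i * Complex.exp (z * r i)‖ ≤ N := by
    intro z hz0 hz1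
    refine PhragmenLindelof.vertical_strip (a := 0) (b := 1) (C := N) hd.diffContOnCl
      ⟨0, by positivity, 0, ?_⟩ hl hr hz0 hz1
    refine Asymptotics.IsBigO.of_bound (∑ i, ‖K i‖ * Real.exp |r i|) ?_
    refine Filter.eventually_inf_principal.mpr (Filter.Eventually.of_forall fun w hw => ?_)
    simp only [zero_mul, Real.exp_zero, norm_one, mul_one]
    refine (norm_sum_le _ _).trans (Finset.sum_le_sum fun i _ => ?_)
    rw [norm_mul, Complex.norm_exp]
    gcongr
    have hw0 : 0 < w.re := hw.1
    have hw1 : w.re < 1 := hw.2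
    simp only [Complex.mul_re, Complex.ofReal_re, Complex.ofReal_im, mul_zero, sub_zero]
    nlinarith [abs_nonneg (r i), le_abs_self (r i)]
  have hder : HasDerivAt (fun t : ℝ => (∑ i, K i * Complex.exp ((t : ℂ) * r i)).re)
      (∑ i, K i * r i).re 0 := by
    have h : HasDerivAt (fun z : ℂ => ∑ i, K i * Complex.exp (z * r i)) (∑ i, K i * r i)
        ((0 : ℝ) : ℂ) := by
      refine HasDerivAt.fun_sum fun i _ => ?_
      have := (((hasDerivAt_id ((0 : ℝ) : ℂ)).mul_const (r i : ℂ)).cexp).const_mul (K i)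
      simpa using this
    exact h.real_of_complex
  refine le_of_tendsto hder.tendsto_slope_zero_right ?_
  have : Set.Ioc (0 : ℝ) 1 ∈ nhdsWithin 0 (Set.Ioi 0) := Ioc_mem_nhdsGT one_pos
  filter_upwards [this] with t ht
  have h1 := (Complex.re_le_norm _).trans (hbd (t : ℂ) (by simpa using ht.1.le) (by simpa using ht.2))
  simp only [zero_add, smul_eq_mul, Complex.ofReal_zero, zero_mul, Complex.exp_zero, mul_one, h0,
    Complex.ofReal_re]
  exact mul_nonpos_of_nonneg_of_nonpos (inv_nonneg.mpr ht.1.le) (by linarith)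

theorem sum_norm_sq_mulVec_of_isometry {ι : Type*} [Fintype ι] [DecidableEq ι]
    {W : Matrix ι ι ℂ} (hW : Wᴴ * W = 1) (a : ι → ℂ) :
    ∑ i, ‖(W *ᵥ a) i‖ ^ 2 = ∑ i, ‖a i‖ ^ 2 := by
  have h : star (W *ᵥ a) ⬝ᵥ (W *ᵥ a) = star a ⬝ᵥ a := by
    rw [star_mulVec, dotProduct_mulVec, vecMul_vecMul, hW, vecMul_one]
  have h2 : ∀ v : ι → ℂ, star v ⬝ᵥ v = ((∑ i, ‖v i‖ ^ 2 : ℝ) : ℂ) := by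
    intro v
    simp [dotProduct, Complex.conj_mul']
  rw [h2, h2] at h
  exact_mod_cast h

/-- The Maassen-Uffink entropic uncertainty relation, for subnormalized vectors. -/
theorem sum_norm_sq_mul_log_add_le {ι : Type*} [Fintype ι] [DecidableEq ι]
    {W : Matrix ι ι ℂ} (hW : Wᴴ * W = 1) {C : ℝ} (hC : 0 < C) (hWC : ∀ i j, ‖W i j‖ ≤ C)
    (a : ι → ℂ) (ha : ∑ i, ‖a i‖ ^ 2 ≤ 1) :
    ∑ i, ‖(W *ᵥ a) i‖ ^ 2 * Real.log (‖(W *ᵥ a) i‖ ^ 2) + ∑ i, ‖a i‖ ^ 2 * Real.log (‖a i‖ ^ 2)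
      ≤ 2 * (∑ i, ‖a i‖ ^ 2) * Real.log C := by
  have hN := sum_norm_sq_mulVec_of_isometry hW a
  set b := W *ᵥ a with hb
  set N := ∑ i, ‖a i‖ ^ 2 with hNdef
  have hN0 : 0 ≤ N := by positivity
  have hKb : ∀ i, ∑ j, star (b i) * W i j * a j = ((‖b i‖ ^ 2 : ℝ) : ℂ) := by
    intro i
    simp_rw [mul_assoc, ← Finset.mul_sum]
    change star (b i) * b i = _
    simp [Complex.conj_mul']
  have hKa : ∀ j, ∑ i, star (b i) * W i j * a j = ((‖a j‖ ^ 2 : ℝ) : ℂ) := by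
    intro j
    rw [← Finset.sum_mul]
    change (star b ᵥ* W) j * a j = _
    rw [hb, star_mulVec, vecMul_vecMul, hW, vecMul_one]
    simp [Complex.conj_mul']
  have hS : ∑ i, ∑ j, star (b i) * W i j * a j = (N : ℂ) := by
    simp_rw [hKb]; rw [← hN]; push_cast; rfl
  have key := re_sum_mul_le_zero_of_norm_exp_sum_le
    (fun p : ι × ι => star (b p.1) * W p.1 p.2 * a p.2)
    (fun p => Real.log ‖b p.1‖ + Real.log ‖a p.2‖ - Real.log C) N
    (by rw [Fintype.sum_prod_type]; exact hS) ?_ ?_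
  · rw [Fintype.sum_prod_type] at key
    have e : ∑ i, ∑ j, star (b i) * W i j * a j *
          ((Real.log ‖b i‖ + Real.log ‖a j‖ - Real.log C : ℝ) : ℂ)
        = ((∑ i, ‖b i‖ ^ 2 * Real.log ‖b i‖ + ∑ j, ‖a j‖ ^ 2 * Real.log ‖a j‖
            - N * Real.log C : ℝ) : ℂ) := by
      have e1 : ∑ i, ∑ j, star (b i) * W i j * a j * (Real.log ‖b i‖ : ℂ)
          = ∑ i, ((‖b i‖ ^ 2 : ℝ) : ℂ) * Real.log ‖b i‖ := by
        simp_rw [← Finset.sum_mul, hKb]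
      have e2 : ∑ i, ∑ j, star (b i) * W i j * a j * (Real.log ‖a j‖ : ℂ)
          = ∑ j, ((‖a j‖ ^ 2 : ℝ) : ℂ) * Real.log ‖a j‖ := by
        rw [Finset.sum_comm]
        refine Finset.sum_congr rfl fun j _ => ?_
        rw [← Finset.sum_mul, hKa]
      have e3 : ∑ i, ∑ j, star (b i) * W i j * a j * (Real.log C : ℂ) = N * Real.log C := by
        simp_rw [← Finset.sum_mul, hS]
      push_cast at e1 e2 e3 ⊢
      rw [← e1, ← e2, ← e3]
      simp only [← Finset.sum_add_distrib, ← Finset.sum_sub_distrib, mul_add, mul_sub]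
    rw [e, Complex.ofReal_re] at key
    simp only [Real.log_pow, Nat.cast_ofNat]
    simp only [mul_left_comm _ (2 : ℝ), ← Finset.mul_sum]
    linarith
  · intro z hz
    have hn : ∀ x : ℝ, ‖Complex.exp (z * x)‖ = 1 := by
      intro x; simp [Complex.norm_exp, hz]
    set a' : ι → ℂ := fun j => a j * Complex.exp (z * (Real.log ‖a j‖ : ℝ))
    set b' : ι → ℂ := fun i => star (b i) * Complex.exp (z * (Real.log ‖b i‖ : ℝ))
    have ha' : ∀ j, ‖a' j‖ = ‖a j‖ := fun j => by simp only [a', norm_mul, hn, mul_one]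
    have hb' : ∀ j, ‖b' j‖ = ‖b j‖ := fun j => by
      simp only [b', norm_mul, hn, mul_one, norm_star]
    have e : ∑ p : ι × ι, star (b p.1) * W p.1 p.2 * a p.2 * Complex.exp
        (z * ((Real.log ‖b p.1‖ + Real.log ‖a p.2‖ - Real.log C : ℝ) : ℂ))
        = (∑ i, b' i * (W *ᵥ a') i) * Complex.exp (z * ((-Real.log C : ℝ) : ℂ)) := by
      rw [Fintype.sum_prod_type, Finset.sum_mul]
      refine Finset.sum_congr rfl fun i _ => ?_
      simp only [mulVec, dotProduct, Finset.mul_sum, Finset.sum_mul]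
      refine Finset.sum_congr rfl fun j _ => ?_
      simp only [a', b']
      push_cast
      rw [mul_sub, mul_add, Complex.exp_sub, Complex.exp_add, mul_neg, Complex.exp_neg]
      ring
    rw [e, norm_mul, hn, mul_one]
    have h2 := sum_norm_sq_mulVec_of_isometry hW a'
    calc ‖∑ i, b' i * (W *ᵥ a') i‖ ≤ ∑ i, ‖b' i * (W *ᵥ a') i‖ := norm_sum_le _ _
      _ ≤ ∑ i, (‖b i‖ ^ 2 + ‖(W *ᵥ a') i‖ ^ 2) / 2 := by
        refine Finset.sum_le_sum fun i _ => ?_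
        rw [norm_mul, hb']
        nlinarith [sq_nonneg (‖b i‖ - ‖(W *ᵥ a') i‖)]
      _ = N := by
        rw [← Finset.sum_div, Finset.sum_add_distrib, hN, h2]
        simp_rw [ha']
        ring
  · intro z hz
    have hx : ∀ x : ℝ, 0 ≤ x → x * Real.exp (Real.log x) = x ^ 2 := by
      intro x hx
      rcases hx.eq_or_lt with h | h
      · simp [← h]
      · rw [Real.exp_log h, sq]
    refine (norm_sum_le _ _).trans ?_
    calc _ ≤ ∑ p : ι × ι, ‖b p.1‖ ^ 2 * ‖a p.2‖ ^ 2 := by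
          refine Finset.sum_le_sum fun p _ => ?_
          have : ‖Complex.exp (z * ((Real.log ‖b p.1‖ + Real.log ‖a p.2‖ - Real.log C : ℝ) : ℂ))‖
              = Real.exp (Real.log ‖b p.1‖) * Real.exp (Real.log ‖a p.2‖) / C := by
            rw [Complex.norm_exp, Complex.re_mul_ofReal, hz, one_mul, Real.exp_sub, Real.exp_add,
              Real.exp_log hC]
          simp only [norm_mul, norm_star, this]
          rw [← hx _ (norm_nonneg (b p.1)), ← hx _ (norm_nonneg (a p.2))]
          calc _ = ‖W p.1 p.2‖ / C * (‖b p.1‖ * Real.exp (Real.log ‖b p.1‖) *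
                (‖a p.2‖ * Real.exp (Real.log ‖a p.2‖))) := by ring
            _ ≤ 1 * _ := by
              gcongr
              exact (div_le_one hC).mpr (hWC _ _)
            _ = _ := one_mul _
      _ = N * N := by
          rw [Fintype.sum_prod_type]
          simp only [← Finset.mul_sum, ← Finset.sum_mul, hN, ← hNdef]
      _ ≤ N := by nlinarith

theorem vnEntropy_diagonal_s8 {m : Type*} [Fintype m] [DecidableEq m] (f : m → ℝ) :
    vnEntropy (Matrix.diagonal fun i => (f i : ℂ)) = -∑ i, f i * Real.logb 2 (f i) := by
  have h : (Matrix.diagonal fun i => (f i : ℂ)).IsHermitian := by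
    refine Matrix.isHermitian_diagonal_of_self_adjoint _ ?_
    ext i
    simp
  rw [vnEntropy, dif_pos h]
  have h1 := h.roots_charpoly_eq_eigenvalues
  rw [Matrix.charpoly_diagonal, Polynomial.roots_prod _ _
    (Finset.prod_ne_zero_iff.mpr fun i _ => Polynomial.X_sub_C_ne_zero _)] at h1
  simp only [Polynomial.roots_X_sub_C, Multiset.bind_singleton] at h1
  have h2 := congrArg
    (fun s : Multiset ℂ => (s.map fun z => z.re * Real.logb 2 z.re).sum) h1
  simp only [Multiset.map_map, Function.comp_def, Complex.ofReal_re, Complex.coe_algebraMap] at h2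
  exact congrArg Neg.neg h2.symm

theorem dotProduct_eq_zero_of_ensemble_eq {X K L : Type*} [Fintype X] [Fintype K] [Fintype L]
    {p : K → ℝ} {ψ : K → X → ℂ} {q : L → ℂ} {φ : L → X → ℂ} (hp : ∀ i, 0 ≤ p i)
    (h : ∑ j, q j • vecMulVec (φ j) (star (φ j)) =
      ∑ i, ((p i : ℝ) : ℂ) • vecMulVec (ψ i) (star (ψ i)))
    {l : X → ℂ} (hl : ∀ j, l ⬝ᵥ φ j = 0) {i : K} (hi : p i ≠ 0) : l ⬝ᵥ ψ i = 0 := by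
  have hv : ∀ v : X → ℂ, l ⬝ᵥ (vecMulVec v (star v) *ᵥ star l)
      = ((‖l ⬝ᵥ v‖ ^ 2 : ℝ) : ℂ) := by
    intro v
    have : vecMulVec v (star v) *ᵥ star l = star (l ⬝ᵥ v) • v := by
      rw [vecMulVec_mulVec, star_dotProduct_star, dotProduct_comm]
      ext; simp [mul_comm]
    rw [this, dotProduct_smul, smul_eq_mul]
    simp [Complex.conj_mul']
  have h1 := congrArg (fun M : Matrix X X ℂ => l ⬝ᵥ (M *ᵥ star l)) h
  simp only [sum_mulVec, dotProduct_sum, smul_mulVec, dotProduct_smul, hv, hl] at h1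
  have h2 : ∑ i, p i * ‖l ⬝ᵥ ψ i‖ ^ 2 = 0 := by
    have : ((∑ i, p i * ‖l ⬝ᵥ ψ i‖ ^ 2 : ℝ) : ℂ) = 0 := by
      push_cast
      simpa using h1.symm
    exact_mod_cast this
  have h3 := (Finset.sum_eq_zero_iff_of_nonneg
    fun i _ => mul_nonneg (hp i) (sq_nonneg _)).mp h2 i (Finset.mem_univ i)
  simpa [hi] using h3

/-- The `l`-th vector of the ensemble realizing `lockState u`, in the Schmidt basis of the
`A : B` cut. -/
noncomputable def lockVec {d : ℕ} (u : Matrix (Fin d) (Fin d) ℂ) (l : Fin d) (a : Fin d × Fin 2) :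
    ℂ :=
  (((Real.sqrt 2 : ℝ) : ℂ))⁻¹ * if a.2 = 0 then u l a.1 else (1 : Matrix (Fin d) (Fin d) ℂ) l a.1

/-- `diagVec v` is the bipartite vector `∑ a, v a |a⟩|a⟩`. -/
def diagVec {α : Type*} [DecidableEq α] (v : α → ℂ) (x : α × α) : ℂ :=
  if x.1 = x.2 then v x.1 else 0

/-- The tensor product of `N` bipartite vectors, regrouped across the `Aⁿ : Bⁿ` cut. -/
def bipProd {α β : Type*} {N : ℕ} (φ : Fin N → α × β → ℂ) (x : (Fin N → α) × (Fin N → β)) : ℂ :=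
  ∏ t, φ t (x.1 t, x.2 t)

/-- The unitary expressing the qubit-`s` component of `lockVec u l` in terms of the other one. -/
def flipMat {d : ℕ} (u : Matrix (Fin d) (Fin d) ℂ) (s : Fin 2) : Matrix (Fin d) (Fin d) ℂ :=
  if s = 0 then uᵀ else uᵀᴴ

theorem inv_sqrt_two_mul_self : (((Real.sqrt 2 : ℝ) : ℂ))⁻¹ * (((Real.sqrt 2 : ℝ) : ℂ))⁻¹ = 2⁻¹ := by
  rw [← mul_inv, ← Complex.ofReal_mul, Real.mul_self_sqrt zero_le_two]
  norm_num

theorem lockState_eq_sum {d : ℕ} {u : Matrix (Fin d) (Fin d) ℂ} (hu : uᴴ * u = 1) :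
    lockState u = ∑ l, ((d : ℂ))⁻¹ •
      vecMulVec (diagVec (lockVec u l)) (star (diagVec (lockVec u l))) := by
  ext ⟨⟨i, s⟩, ⟨i', s'⟩⟩ ⟨⟨j, r⟩, ⟨j', r'⟩⟩
  have hE : ∀ i j, ∑ l, u l i * star (u l j) = if i = j then 1 else 0 := by
    intro i j
    have := congrFun (congrFun hu j) i
    simp only [mul_apply, conjTranspose_apply, one_apply, eq_comm (a := j)] at this
    rw [← this]
    exact Finset.sum_congr rfl fun l _ => mul_comm _ _
  have hcross : ∀ (P Q : Fin d → ℂ) (e : ℂ), ∑ l, P l * star (Q l) = e →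
      ∑ l, (((Real.sqrt 2 : ℝ) : ℂ))⁻¹ * P l * ((((Real.sqrt 2 : ℝ) : ℂ))⁻¹ * star (Q l))
        = 2⁻¹ * e := by
    intro P Q e h
    rw [← h, ← inv_sqrt_two_mul_self, Finset.mul_sum]
    exact Finset.sum_congr rfl fun l _ => by ring
  simp only [Matrix.sum_apply, Matrix.smul_apply, smul_eq_mul, ← Finset.mul_sum, vecMulVec_apply,
    Pi.star_apply, diagVec]
  by_cases hx : ((i, s) : Fin d × Fin 2) = (i', s')
  · by_cases hy : ((j, r) : Fin d × Fin 2) = (j', r')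
    · obtain ⟨rfl, rfl⟩ := Prod.mk.inj hx
      obtain ⟨rfl, rfl⟩ := Prod.mk.inj hy
      simp only [if_true, lockVec, star_mul', star_inv₀, Complex.star_def, Complex.conj_ofReal]
      simp only [Complex.star_def] at hcross hE
      rw [hcross _ _ _ rfl]
      fin_cases s <;> fin_cases r
      · have hEij := hE i j
        by_cases hij : i = j
        · subst hij
          simp [lockState, embedQ, maxCorr, hEij, mul_comm]
        · simp [lockState, embedQ, maxCorr, hEij, hij]
      · simp [lockState, embedQ, diagU, one_apply]
        ring
      · simp [lockState, embedQ, diagU, one_apply]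
        ring
      · by_cases hij : i = j
        · simp [lockState, embedQ, maxCorr, one_apply, hij, mul_comm]
        · simp [lockState, embedQ, maxCorr, one_apply, hij, Ne.symm hij]
    · rw [Finset.sum_eq_zero fun l _ => by simp [hy]]
      have hy' : j = j' → r ≠ r' := fun h1 h2 => hy (by rw [h1, h2])
      fin_cases r <;> fin_cases r' <;> simp_all [lockState, embedQ, maxCorr, diagU]
  · rw [Finset.sum_eq_zero fun l _ => by simp [hx]]
    have hx' : i = i' → s ≠ s' := fun h1 h2 => hx (by rw [h1, h2])
    fin_cases s <;> fin_cases s' <;> simp_all [lockState, embedQ, maxCorr, diagU]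

theorem sum_norm_sq_lockVec {d : ℕ} {u : Matrix (Fin d) (Fin d) ℂ} (hu : u * uᴴ = 1) (l : Fin d) :
    ∑ a, ‖lockVec u l a‖ ^ 2 = 1 := by
  have hE : ∑ i, ‖u l i‖ ^ 2 = 1 := by
    have := congrFun (congrFun hu l) l
    simp only [mul_apply, conjTranspose_apply, one_apply_eq, Complex.star_def,
      Complex.mul_conj'] at this
    exact_mod_cast this
  have h2 : ‖(((Real.sqrt 2 : ℝ) : ℂ))⁻¹‖ ^ 2 = 2⁻¹ := by simp
  rw [Fintype.sum_prod_type]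
  simp only [Fin.sum_univ_two, lockVec, norm_mul, mul_pow, h2, if_true, one_ne_zero, if_false,
    Finset.sum_add_distrib, ← Finset.mul_sum, hE, one_apply]
  simp [apply_ite]
  norm_num

theorem lockVec_eq_sum_flipMat {d : ℕ} {u : Matrix (Fin d) (Fin d) ℂ} (hu : u * uᴴ = 1)
    (l i : Fin d) (s : Fin 2) :
    lockVec u l (i, s) = ∑ j, flipMat u s i j * lockVec u l (j, 1 - s) := by
  have hE : ∑ j, star (u i j) * u l j = (1 : Matrix (Fin d) (Fin d) ℂ) l i := by
    rw [← hu, mul_apply]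
    exact Finset.sum_congr rfl fun j _ => mul_comm _ _
  simp only [lockVec, mul_left_comm (flipMat u s i _), ← Finset.mul_sum]
  congr 1
  fin_cases s
  · simp [flipMat, one_apply]
  · simpa [flipMat] using hE.symm

theorem conjTranspose_flipMat_mul {d : ℕ} {u : Matrix (Fin d) (Fin d) ℂ} (hu : u * uᴴ = 1)
    (s : Fin 2) : (flipMat u s)ᴴ * flipMat u s = 1 := by
  have hu' : uᴴ * u = 1 := mul_eq_one_comm.mp hu
  have hc : uᵀᴴ = uᴴᵀ := rfl
  fin_cases s
  · have := congrArg transpose hu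
    simpa [flipMat, transpose_mul, hc] using this
  · have := congrArg transpose hu'
    simpa [flipMat, transpose_mul, ← hc] using this

theorem norm_flipMat_le {d : ℕ} {u : Matrix (Fin d) (Fin d) ℂ} {c : ℝ} (hc : ∀ i j, ‖u i j‖ ≤ c)
    (s : Fin 2) (i j : Fin d) : ‖flipMat u s i j‖ ≤ c := by
  fin_cases s <;> simp [flipMat, hc]

/-- The tensor product of `N` matrices. -/
def tensorMat {ι : Type*} {N : ℕ} (M : Fin N → Matrix ι ι ℂ) :
    Matrix (Fin N → ι) (Fin N → ι) ℂ :=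
  fun I J => ∏ t, M t (I t) (J t)

theorem sum_prod_eq_prod_sum {ι : Type*} [Fintype ι] {N : ℕ} (f : Fin N → ι → ℂ) :
    ∑ J : Fin N → ι, ∏ t, f t (J t) = ∏ t, ∑ j, f t j := by
  classical
  rw [Finset.prod_univ_sum, Fintype.piFinset_univ]

theorem conjTranspose_tensorMat_mul {ι : Type*} [Fintype ι] [DecidableEq ι] {N : ℕ}
    {M : Fin N → Matrix ι ι ℂ} (hM : ∀ t, (M t)ᴴ * M t = 1) :
    (tensorMat M)ᴴ * tensorMat M = 1 := by
  ext I J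
  simp only [mul_apply, conjTranspose_apply, tensorMat, star_prod, ← Finset.prod_mul_distrib]
  rw [sum_prod_eq_prod_sum fun t j => star (M t j (I t)) * M t j (J t)]
  have : ∀ t, ∑ j, star (M t j (I t)) * M t j (J t) = if I t = J t then 1 else 0 := by
    intro t
    have := congrFun (congrFun (hM t) (I t)) (J t)
    simpa only [mul_apply, conjTranspose_apply, one_apply] using this
  simp only [this, one_apply, Finset.prod_ite_zero, Finset.mem_univ, true_imp_iff,
    Finset.prod_const_one, funext_iff]

theorem norm_tensorMat_le {ι : Type*} {N : ℕ} {M : Fin N → Matrix ι ι ℂ} {c : ℝ}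
    (hM : ∀ t i j, ‖M t i j‖ ≤ c) (I J : Fin N → ι) : ‖tensorMat M I J‖ ≤ c ^ N := by
  rw [tensorMat, norm_prod]
  refine (Finset.prod_le_prod (fun t _ => norm_nonneg _) fun t _ => hM t _ _).trans ?_
  simp

theorem bipPow_sum_smul_vecMulVec {α β L : Type*} [Fintype α] [Fintype β] [Fintype L] {q : ℂ}
    (φ : L → α × β → ℂ) (N : ℕ) :
    bipPow (∑ l, q • vecMulVec (φ l) (star (φ l))) N =
      ∑ J : Fin N → L, q ^ N •
        vecMulVec (bipProd fun t => φ (J t)) (star (bipProd fun t => φ (J t))) := by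
  ext x y
  simp only [bipPow, Matrix.sum_apply, Matrix.smul_apply, smul_eq_mul, vecMulVec_apply,
    Pi.star_apply, bipProd, star_prod]
  rw [← sum_prod_eq_prod_sum
    fun t l => q * (φ l (x.1 t, x.2 t) * star (φ l (y.1 t, y.2 t)))]
  simp [Finset.prod_mul_distrib]

theorem sum_normSq_bipProd {α : Type*} [Fintype α] {N : ℕ} (φ : Fin N → α × α → ℂ)
    (hφ : ∀ t, ∑ x, ‖φ t x‖ ^ 2 = 1) : ∑ x, Complex.normSq (bipProd φ x) = 1 := by
  classical
  rw [← (Equiv.arrowProdEquivProdArrow (Fin N) (fun _ => α) (fun _ => α)).sum_comp]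
  simp only [Equiv.arrowProdEquivProdArrow_apply, bipProd, map_prod, Complex.normSq_eq_norm_sq,
    Prod.mk.eta]
  rw [← Fintype.piFinset_univ, ← Finset.prod_univ_sum (fun _ => Finset.univ)
    fun t x => ‖φ t x‖ ^ 2]
  simp [hφ]

theorem sum_norm_sq_diagVec {α : Type*} [Fintype α] [DecidableEq α] (v : α → ℂ) :
    ∑ x, ‖diagVec v x‖ ^ 2 = ∑ a, ‖v a‖ ^ 2 := by
  rw [Fintype.sum_prod_type]
  simp [diagVec, apply_ite]

/-- A pure state whose coefficient matrix is diagonal has a diagonal reduced state. -/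
theorem vnEntropy_ptraceB_of_diagonal {α : Type*} [Fintype α] [DecidableEq α] {ψ : α × α → ℂ}
    (hψ : ∀ x : α × α, x.1 ≠ x.2 → ψ x = 0) :
    vnEntropy (ptraceB (vecMulVec ψ (star ψ))) =
      -∑ a, ‖ψ (a, a)‖ ^ 2 * Real.logb 2 (‖ψ (a, a)‖ ^ 2) := by
  rw [← vnEntropy_diagonal_s8]
  congr 1
  ext a b
  simp only [ptraceB, vecMulVec_apply, Pi.star_apply]
  rw [Finset.sum_eq_single a (fun c _ hc => by rw [hψ (a, c) hc.symm, zero_mul]) (by simp)]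
  by_cases h : a = b
  · subst h
    simp [Complex.mul_conj']
  · rw [hψ (b, a) fun h' => h h'.symm, diagonal_apply_ne _ h, star_zero, mul_zero]

/-- The entropy bound for pure states whose components satisfy the flip relation. -/
theorem le_vnEntropy_of_flip {d n : ℕ} {u : Matrix (Fin d) (Fin d) ℂ} (hu : u * uᴴ = 1) {c : ℝ}
    (hc0 : 0 < c) (hc : ∀ i j, ‖u i j‖ ≤ c)
    {ψ : (Fin n → Fin d × Fin 2) × (Fin n → Fin d × Fin 2) → ℂ}
    (hnorm : ∑ x, Complex.normSq (ψ x) = 1) (hψ : ∀ x, x.1 ≠ x.2 → ψ x = 0)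
    (hflip : ∀ (s : Fin n → Fin 2) (I : Fin n → Fin d),
      ψ (fun t => (I t, s t), fun t => (I t, s t)) =
        ∑ J, tensorMat (fun t => flipMat u (s t)) I J *
          ψ (fun t => (J t, (1 - s) t), fun t => (J t, (1 - s) t))) :
    -(n * Real.logb 2 c) ≤ vnEntropy (ptraceB (vecMulVec ψ (star ψ))) := by
  rw [vnEntropy_ptraceB_of_diagonal hψ]
  set v : (Fin n → Fin 2) → (Fin n → Fin d) → ℂ :=
    fun s I => ψ (fun t => (I t, s t), fun t => (I t, s t)) with hv
  have hflip' : ∀ s, v s = tensorMat (fun t => flipMat u (s t)) *ᵥ v (1 - s) :=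
    fun s => funext fun I => hflip s I
  have hsum : ∀ f : ℂ → ℝ, ∑ a, f (ψ (a, a)) = ∑ s, ∑ I, f (v s I) := by
    intro f
    rw [← (Equiv.arrowProdEquivProdArrow (Fin n) (fun _ => Fin d) (fun _ => Fin 2)).symm.sum_comp,
      Fintype.sum_prod_type_right]
    rfl
  have hN : ∑ s, ∑ I, ‖v s I‖ ^ 2 = 1 := by
    rw [← hsum fun z => ‖z‖ ^ 2, ← hnorm, Fintype.sum_prod_type]
    refine Finset.sum_congr rfl fun a _ => ?_
    rw [Finset.sum_eq_single a (fun b _ hb => by rw [hψ (a, b) hb.symm, map_zero]) (by simp),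
      Complex.normSq_eq_norm_sq]
  have hN1 : ∀ s, ∑ I, ‖v s I‖ ^ 2 ≤ 1 := fun s => hN ▸
    Finset.single_le_sum (f := fun s => ∑ I, ‖v s I‖ ^ 2)
      (fun s _ => Finset.sum_nonneg fun I _ => sq_nonneg _) (Finset.mem_univ s)
  set E : (Fin n → Fin 2) → ℝ := fun s => ∑ I, ‖v s I‖ ^ 2 * Real.log (‖v s I‖ ^ 2) with hE
  have hpair : ∀ s, E s + E (1 - s) ≤ 2 * (∑ I, ‖v (1 - s) I‖ ^ 2) * Real.log (c ^ n) := by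
    intro s
    have h := sum_norm_sq_mul_log_add_le
      (conjTranspose_tensorMat_mul fun t => conjTranspose_flipMat_mul hu (s t)) (pow_pos hc0 n)
      (norm_tensorMat_le fun t => norm_flipMat_le hc (s t)) (v (1 - s)) (hN1 _)
    rwa [← hflip'] at h
  have htot := Finset.sum_le_sum fun s (_ : s ∈ Finset.univ) => hpair s
  have hre : ∀ g : (Fin n → Fin 2) → ℝ, ∑ s, g (1 - s) = ∑ s, g s :=
    fun g => (Equiv.subLeft (1 : Fin n → Fin 2)).sum_comp g
  rw [Finset.sum_add_distrib, hre E, ← Finset.sum_mul, ← Finset.mul_sum,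
    hre fun s => ∑ I, ‖v s I‖ ^ 2, hN, Real.log_pow] at htot
  rw [hsum fun z => ‖z‖ ^ 2 * Real.logb 2 (‖z‖ ^ 2)]
  simp only [Real.logb, ← mul_div_assoc, ← Finset.sum_div]
  change _ ≤ -((∑ s, E s) / Real.log 2)
  have hl : 0 < Real.log 2 := Real.log_pos one_lt_two
  gcongr
  linarith

theorem bipProd_diagVec_of_ne {α : Type*} [DecidableEq α] {N : ℕ} (v : Fin N → α → ℂ)
    {x : (Fin N → α) × (Fin N → α)} (hx : x.1 ≠ x.2) : bipProd (fun t => diagVec (v t)) x = 0 := by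
  obtain ⟨t, ht⟩ := Function.ne_iff.mp hx
  exact Finset.prod_eq_zero (Finset.mem_univ t) (if_neg ht)

theorem bipProd_diagVec_self {α : Type*} [DecidableEq α] {N : ℕ} (v : Fin N → α → ℂ)
    (a : Fin N → α) : bipProd (fun t => diagVec (v t)) (a, a) = ∏ t, v t (a t) :=
  Finset.prod_congr rfl fun _ _ => if_pos rfl

theorem bipProd_lockVec_flip {d n : ℕ} {u : Matrix (Fin d) (Fin d) ℂ} (hu : u * uᴴ = 1)
    (L : Fin n → Fin d) (s : Fin n → Fin 2) (I : Fin n → Fin d) :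
    bipProd (fun t => diagVec (lockVec u (L t)))
        (fun t => (I t, s t), fun t => (I t, s t)) =
      ∑ J, tensorMat (fun t => flipMat u (s t)) I J *
        bipProd (fun t => diagVec (lockVec u (L t)))
          (fun t => (J t, (1 - s) t), fun t => (J t, (1 - s) t)) := by
  simp only [bipProd_diagVec_self, tensorMat, ← Finset.prod_mul_distrib]
  rw [sum_prod_eq_prod_sum
    fun t j => flipMat u (s t) (I t) j * lockVec u (L t) (j, (1 - s) t)]
  exact Finset.prod_congr rfl fun t _ => lockVec_eq_sum_flipMat hu _ _ _

theorem le_eof_bipPow_lockState {d : ℕ} [NeZero d] {u : Matrix (Fin d) (Fin d) ℂ}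
    (hu : u * uᴴ = 1) {c : ℝ} (hc0 : 0 < c) (hc : ∀ i j, ‖u i j‖ ≤ c) (n : ℕ) :
    -(n * Real.logb 2 c) ≤ eof (bipPow (lockState u) n) := by
  have hρ := bipPow_sum_smul_vecMulVec (q := ((d : ℂ))⁻¹) (fun l => diagVec (lockVec u l)) n
  rw [← lockState_eq_sum (mul_eq_one_comm.mp hu)] at hρ
  refine le_csInf ?_ ?_
  · let e := Fintype.equivFin (Fin n → Fin d)
    refine ⟨_, Fintype.card (Fin n → Fin d), fun _ => ((d : ℝ))⁻¹ ^ n,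
      fun i => bipProd fun t => diagVec (lockVec u (e.symm i t)), fun _ => by positivity, ?_,
      fun i => ?_, ?_, rfl⟩
    · simp [NeZero.ne d]
    · exact sum_normSq_bipProd _ fun t => by
        rw [sum_norm_sq_diagVec, sum_norm_sq_lockVec hu]
    · rw [hρ, ← e.symm.sum_comp]
      push_cast
      rfl
  · rintro x ⟨K, p, ψ, hp, hp1, hnorm, hens, rfl⟩
    rw [hρ] at hens
    have hbound : ∀ i, p i * -(n * Real.logb 2 c) ≤
        p i * vnEntropy (ptraceB (vecMulVec (ψ i) (star (ψ i)))) := by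
      intro i
      rcases eq_or_ne (p i) 0 with h0 | h0
      · simp [h0]
      refine mul_le_mul_of_nonneg_left (le_vnEntropy_of_flip hu hc0 hc (hnorm i) ?_ ?_) (hp i)
      · intro x hx
        have := dotProduct_eq_zero_of_ensemble_eq hp hens (l := Pi.single x 1)
          (fun L => by rw [single_one_dotProduct]; exact bipProd_diagVec_of_ne _ hx) h0
        rwa [single_one_dotProduct] at this
      · intro s I
        let l : (Fin n → Fin d × Fin 2) × (Fin n → Fin d × Fin 2) → ℂ :=
          Pi.single (fun t => (I t, s t), fun t => (I t, s t)) 1 -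
            ∑ J, tensorMat (fun t => flipMat u (s t)) I J •
              Pi.single (fun t => (J t, (1 - s) t), fun t => (J t, (1 - s) t)) 1
        have hl : ∀ φ, l ⬝ᵥ φ = φ (fun t => (I t, s t), fun t => (I t, s t)) -
            ∑ J, tensorMat (fun t => flipMat u (s t)) I J *
              φ (fun t => (J t, (1 - s) t), fun t => (J t, (1 - s) t)) := by
          intro φ
          simp only [l, sub_dotProduct, sum_dotProduct, smul_dotProduct, single_one_dotProduct,
            smul_eq_mul]
        have := dotProduct_eq_zero_of_ensemble_eq hp hens (l := l)
          (fun L => by rw [hl, sub_eq_zero]; exact bipProd_lockVec_flip hu L s I) h0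
        rwa [hl, sub_eq_zero] at this
    have := Finset.sum_le_sum fun i (_ : i ∈ Finset.univ) => hbound i
    rwa [← Finset.sum_mul, hp1, one_mul] at this

theorem hadamard_mul_conjTranspose : _root_.hadamard * _root_.hadamardᴴ = 1 := by
  ext i j
  have h := inv_sqrt_two_mul_self
  fin_cases i <;> fin_cases j <;>
    simp [_root_.hadamard, mul_apply, Fin.sum_univ_two, h] <;> norm_num

theorem norm_hadamard (i j : Fin 2) : ‖_root_.hadamard i j‖ = (Real.sqrt 2)⁻¹ := by
  fin_cases i <;> fin_cases j <;> simp [_root_.hadamard]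

theorem hadamardPow_mul_conjTranspose (k : ℕ) : hadamardPow k * (hadamardPow k)ᴴ = 1 := by
  induction k with
  | zero => simp [hadamardPow]
  | succ k ih =>
    rw [hadamardPow, conjTranspose_reindex, reindex_apply, reindex_apply, submatrix_mul_equiv,
      conjTranspose_kronecker, ← mul_kronecker_mul, hadamard_mul_conjTranspose, ih,
      one_kronecker_one, submatrix_one_equiv]

theorem norm_hadamardPow (k : ℕ) (i j : Fin (2 ^ k)) :
    ‖hadamardPow k i j‖ ≤ (Real.sqrt 2)⁻¹ ^ k := by
  induction k with
  | zero =>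
    rw [hadamardPow, one_apply]
    split_ifs <;> simp
  | succ k ih =>
    rw [hadamardPow, reindex_apply, submatrix_apply, kroneckerMap_apply, norm_mul,
      norm_hadamard, pow_succ' (Real.sqrt 2)⁻¹]
    gcongr
    exact ih _ _

/-- For `u = H^{⊗k}`, `E_F(ρ_AB^{⊗n}) ≥ n (log₂ d)/2 = n k/2` for every `n ≥ 1`;
consequently the entanglement cost `E_c(ρ_AB) = lim_n E_F(ρ_AB^{⊗n})/n` is at least
`(log₂ d)/2 = k/2`. -/
theorem eof_pow_lockState_hadamard_ge (k : ℕ) (hk : 1 ≤ k) :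
    (∀ n : ℕ, 1 ≤ n →
      eof (bipPow (lockState (hadamardPow k)) n) ≥ (n : ℝ) * (k : ℝ) / 2) ∧
    (∀ Ec : ℝ,
      Filter.Tendsto (fun n : ℕ => eof (bipPow (lockState (hadamardPow k)) n) / (n : ℝ))
        Filter.atTop (nhds Ec) → Ec ≥ (k : ℝ) / 2) := by
  have hmain : ∀ n : ℕ, eof (bipPow (lockState (hadamardPow k)) n) ≥ (n : ℝ) * (k : ℝ) / 2 := by
    intro n
    refine le_of_eq_of_le ?_ (le_eof_bipPow_lockState (hadamardPow_mul_conjTranspose k)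
      (by positivity) (norm_hadamardPow k) n)
    rw [Real.logb_pow, Real.logb_inv, Real.sqrt_eq_rpow, Real.logb_rpow two_pos (by norm_num)]
    ring
  refine ⟨fun n _ => hmain n, fun Ec hEc => ge_of_tendsto hEc ?_⟩
  filter_upwards [Filter.eventually_ge_atTop 1] with n hn
  have hn' : (0 : ℝ) < n := by exact_mod_cast hn
  rw [le_div_iff₀ hn']
  linarith [hmain n]
end
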